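/- Let (v,u,θ,w,b) be a classical solution of the planar compressible MHD system on ℝ × [0,T] whose initial energy e₀ is finite and positive, and let 0 < α₁ < 1 < α₂ be the two roots of the equation z − ln z − 1 = e₀. Then for every integer N and every t ∈ [0,T]: α₁ ≤ ∫_N^{N+1} v(x,t) dx ≤ α₂ and α₁ ≤ ∫_N^{N+1} θ(x,t) dx ≤ α₂. -/

import Mathlib

open MeasureTheory Set Filter

noncomputable section

/-- Viscosity function `μ(z) = 1 + α z^(−α)` (here `μ̃₁ = 1`, `μ̃₂ = α`). -/
def visc (α z : ℝ) : ℝ := 1 + α * z ^ (-α)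

/-- Squared Euclidean norm on `ℝ × ℝ` (used for the transverse fields `w, b ∈ ℝ²`). -/
def sq2 (p : ℝ × ℝ) : ℝ := p.1 ^ 2 + p.2 ^ 2

/-- Partial derivative with respect to the first (spatial) variable. -/
def pdx {E : Type*} [NormedAddCommGroup E] [NormedSpace ℝ E]
    (f : ℝ → ℝ → E) (x t : ℝ) : E := deriv (fun y => f y t) x

/-- Partial derivative with respect to the second (time) variable, taken within `[0, T]`
(so it is one-sided at the endpoints). -/
def pdt (T : ℝ) {E : Type*} [NormedAddCommGroup E] [NormedSpace ℝ E]
    (f : ℝ → ℝ → E) (x t : ℝ) : E := derivWithin (fun s => f x s) (Icc 0 T) t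

/-- A classical solution of the planar compressible MHD system (in Lagrangian coordinates,
with all physical constants normalized to `1` and `μ̃₂ = α`) on `ℝ × [0,T]`:
all the derivatives appearing in the equations exist and are continuous, `v, θ > 0`,
the five equations hold pointwise, the solution tends to `(1,0,1,0,0)` as `|x| → ∞`
uniformly in `t ∈ [0,T]`, and `v−1, u, θ−1, b, w` and their first spatial derivatives
are square-integrable in `x` for each `t ∈ [0,T]`. -/
structure IsClassicalSolution (α β T : ℝ) (v u θ : ℝ → ℝ → ℝ)
    (w b : ℝ → ℝ → ℝ × ℝ) : Prop where
  v_pos : ∀ x : ℝ, ∀ t ∈ Icc (0:ℝ) T, 0 < v x t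
  θ_pos : ∀ x : ℝ, ∀ t ∈ Icc (0:ℝ) T, 0 < θ x t
  diff_x : ∀ x : ℝ, ∀ t ∈ Icc (0:ℝ) T,
    DifferentiableAt ℝ (fun y => v y t) x ∧ DifferentiableAt ℝ (fun y => u y t) x ∧
    DifferentiableAt ℝ (fun y => θ y t) x ∧ DifferentiableAt ℝ (fun y => w y t) x ∧
    DifferentiableAt ℝ (fun y => b y t) x
  diff_xx : ∀ x : ℝ, ∀ t ∈ Icc (0:ℝ) T,
    DifferentiableAt ℝ (fun y => pdx u y t) x ∧ DifferentiableAt ℝ (fun y => pdx θ y t) x ∧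
    DifferentiableAt ℝ (fun y => pdx w y t) x ∧ DifferentiableAt ℝ (fun y => pdx b y t) x
  diff_t : ∀ x : ℝ, ∀ t ∈ Icc (0:ℝ) T,
    DifferentiableWithinAt ℝ (fun s => v x s) (Icc 0 T) t ∧
    DifferentiableWithinAt ℝ (fun s => u x s) (Icc 0 T) t ∧
    DifferentiableWithinAt ℝ (fun s => θ x s) (Icc 0 T) t ∧
    DifferentiableWithinAt ℝ (fun s => w x s) (Icc 0 T) t ∧
    DifferentiableWithinAt ℝ (fun s => b x s) (Icc 0 T) t
  cont : ContinuousOn (fun p : ℝ × ℝ =>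
      (v p.1 p.2, u p.1 p.2, θ p.1 p.2, w p.1 p.2, b p.1 p.2)) (univ ×ˢ Icc 0 T)
  cont_dx : ContinuousOn (fun p : ℝ × ℝ =>
      (pdx v p.1 p.2, pdx u p.1 p.2, pdx θ p.1 p.2, pdx w p.1 p.2, pdx b p.1 p.2))
      (univ ×ˢ Icc 0 T)
  cont_dxx : ContinuousOn (fun p : ℝ × ℝ =>
      (pdx (pdx u) p.1 p.2, pdx (pdx θ) p.1 p.2, pdx (pdx w) p.1 p.2, pdx (pdx b) p.1 p.2))
      (univ ×ˢ Icc 0 T)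
  cont_dt : ContinuousOn (fun p : ℝ × ℝ =>
      (pdt T v p.1 p.2, pdt T u p.1 p.2, pdt T θ p.1 p.2, pdt T w p.1 p.2, pdt T b p.1 p.2))
      (univ ×ˢ Icc 0 T)
  eq_mass : ∀ x : ℝ, ∀ t ∈ Icc (0:ℝ) T, pdt T v x t = pdx u x t
  eq_mom : ∀ x : ℝ, ∀ t ∈ Icc (0:ℝ) T,
    pdt T u x t + pdx (fun y s => θ y s / v y s + sq2 (b y s) / 2) x t
      = pdx (fun y s => visc α (v y s) * pdx u y s / v y s) x t
  eq_w : ∀ x : ℝ, ∀ t ∈ Icc (0:ℝ) T,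
    pdt T w x t - pdx b x t = pdx (fun y s => (v y s)⁻¹ • pdx w y s) x t
  eq_b : ∀ x : ℝ, ∀ t ∈ Icc (0:ℝ) T,
    pdt T (fun y s => v y s • b y s) x t - pdx w x t
      = pdx (fun y s => (v y s)⁻¹ • pdx b y s) x t
  eq_temp : ∀ x : ℝ, ∀ t ∈ Icc (0:ℝ) T,
    pdt T θ x t + θ x t / v x t * pdx u x t
      = pdx (fun y s => θ y s ^ β * pdx θ y s / v y s) x t
        + (visc α (v x t) * pdx u x t ^ 2 + sq2 (pdx w x t) + sq2 (pdx b x t)) / v x t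
  farfield : ∀ ε > (0:ℝ), ∃ M : ℝ, ∀ x : ℝ, ∀ t ∈ Icc (0:ℝ) T, M ≤ |x| →
    |v x t - 1| < ε ∧ |u x t| < ε ∧ |θ x t - 1| < ε ∧
    Real.sqrt (sq2 (b x t)) < ε ∧ Real.sqrt (sq2 (w x t)) < ε
  sq_int : ∀ t ∈ Icc (0:ℝ) T,
    Integrable (fun x => (v x t - 1) ^ 2) ∧ Integrable (fun x => (u x t) ^ 2) ∧
    Integrable (fun x => (θ x t - 1) ^ 2) ∧ Integrable (fun x => sq2 (b x t)) ∧
    Integrable (fun x => sq2 (w x t)) ∧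
    Integrable (fun x => (pdx v x t) ^ 2) ∧ Integrable (fun x => (pdx u x t) ^ 2) ∧
    Integrable (fun x => (pdx θ x t) ^ 2) ∧ Integrable (fun x => sq2 (pdx b x t)) ∧
    Integrable (fun x => sq2 (pdx w x t))

/-- The initial data of a solution are `(K, δ)`-admissible: the `H¹`-type norm of
`(v₀−1, u₀, θ₀−1, b₀, w₀)` is at most `K²` and `v₀ ≥ δ`, `θ₀ ≥ δ`. -/
def Admissible (K δ : ℝ) (v u θ : ℝ → ℝ → ℝ) (w b : ℝ → ℝ → ℝ × ℝ) : Prop :=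
  (∫ x : ℝ, ((v x 0 - 1) ^ 2 + (u x 0) ^ 2 + (θ x 0 - 1) ^ 2 + sq2 (b x 0) + sq2 (w x 0)
      + (pdx v x 0) ^ 2 + (pdx u x 0) ^ 2 + (pdx θ x 0) ^ 2
      + sq2 (pdx b x 0) + sq2 (pdx w x 0))) ≤ K ^ 2 ∧
  (∀ x : ℝ, δ ≤ v x 0) ∧ (∀ x : ℝ, δ ≤ θ x 0)

theorem mem_Icc_of_sub_log_le {a₁ a₂ e m : ℝ} (ha₁ : 0 < a₁) (ha₁' : a₁ < 1) (ha₂ : 1 < a₂)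
    (h₁ : a₁ - Real.log a₁ - 1 = e) (h₂ : a₂ - Real.log a₂ - 1 = e) (hm : 0 < m)
    (h : m - Real.log m - 1 ≤ e) : a₁ ≤ m ∧ m ≤ a₂ := by
  constructor
  · by_contra! hlt
    have hlog := Real.log_le_sub_one_of_pos (div_pos hm ha₁)
    rw [Real.log_div hm.ne' ha₁.ne'] at hlog
    have : m / a₁ - 1 < m - a₁ := by
      rw [div_sub_one ha₁.ne', div_lt_iff₀ ha₁]
      nlinarith
    linarith
  · by_contra! hlt
    have ha₂0 : 0 < a₂ := by linarith
    have hlog := Real.log_le_sub_one_of_pos (div_pos hm ha₂0)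
    rw [Real.log_div hm.ne' ha₂0.ne'] at hlog
    have : m / a₂ - 1 < m - a₂ := by
      rw [div_sub_one ha₂0.ne', div_lt_iff₀ ha₂0]
      nlinarith
    linarith

theorem sub_log_integral_le {f : ℝ → ℝ} (hf : Continuous f) (hpos : ∀ x, 0 < f x) (a : ℝ) :
    0 < (∫ x in a..(a + 1), f x) ∧
    (∫ x in a..(a + 1), f x) - Real.log (∫ x in a..(a + 1), f x) - 1
      ≤ ∫ x in a..(a + 1), (f x - Real.log (f x) - 1) := by
  have hm : 0 < ∫ x in a..(a + 1), f x :=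
    intervalIntegral.intervalIntegral_pos_of_pos (hf.intervalIntegrable _ _) hpos (by linarith)
  refine ⟨hm, ?_⟩
  set m := ∫ x in a..(a + 1), f x with hmdef
  have hlog : Continuous fun x => Real.log (f x) := hf.log fun x => (hpos x).ne'
  have h1 : ∫ x in a..(a + 1), (f x - (Real.log m + f x / m - 1) - 1)
      ≤ ∫ x in a..(a + 1), (f x - Real.log (f x) - 1) := by
    apply intervalIntegral.integral_mono_on (by linarith)
    · exact Continuous.intervalIntegrable (by fun_prop) _ _
    · exact Continuous.intervalIntegrable (by fun_prop) _ _
    · intro x _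
      have := Real.log_le_sub_one_of_pos (div_pos (hpos x) hm)
      rw [Real.log_div (hpos x).ne' hm.ne'] at this
      linarith
  have h2 : ∫ x in a..(a + 1), (f x - (Real.log m + f x / m - 1) - 1)
      = m - Real.log m - 1 := by
    have : ∀ x, f x - (Real.log m + f x / m - 1) - 1 = f x - f x / m - Real.log m := by
      intro x; ring
    simp_rw [this]
    rw [intervalIntegral.integral_sub, intervalIntegral.integral_sub,
      intervalIntegral.integral_div, ← hmdef, div_self hm.ne']
    · simp; ring
    all_goals exact Continuous.intervalIntegrable (by fun_prop) _ _
  linarith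

theorem exists_le_add_div_of_tendsto {T : ℝ} {K : ℝ → ℝ → ℝ}
    (hK : ContinuousOn (fun p : ℝ × ℝ => K p.1 p.2) (univ ×ˢ Icc 0 T))
    (hfar : ∀ ε > (0 : ℝ), ∃ M : ℝ, ∀ x, ∀ t ∈ Icc (0 : ℝ) T, M ≤ |x| → K x t < ε)
    {ε : ℝ} (hε : 0 < ε) :
    ∃ C : ℝ, 0 ≤ C ∧ ∀ x, ∀ t ∈ Icc (0 : ℝ) T, K x t ≤ ε + C * (1 + x ^ 2)⁻¹ := by
  obtain ⟨M, hM⟩ := hfar ε hε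
  obtain ⟨B, hB⟩ := ((isCompact_Icc (a := -M) (b := M)).prod
    (isCompact_Icc (a := (0 : ℝ)) (b := T))).exists_bound_of_continuousOn
    (hK.mono (prod_mono (subset_univ _) subset_rfl))
  refine ⟨|B| * (1 + M ^ 2), by positivity, fun x t ht => ?_⟩
  by_cases hx : M ≤ |x|
  · have := hM x t ht hx
    have : 0 ≤ |B| * (1 + M ^ 2) * (1 + x ^ 2)⁻¹ := by positivity
    linarith
  · push Not at hx
    have hb := hB (x, t) ⟨abs_le.1 hx.le, ht⟩
    have h1 : K x t ≤ |B| := (le_abs_self _).trans (hb.trans (le_abs_self _))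
    have h2 : |B| ≤ |B| * (1 + M ^ 2) * (1 + x ^ 2)⁻¹ := by
      rw [← div_eq_mul_inv, le_div_iff₀ (by positivity)]
      have : x ^ 2 ≤ M ^ 2 := by
        rw [← sq_abs x]; exact pow_le_pow_left₀ (abs_nonneg _) hx.le 2
      gcongr
    linarith

theorem weighted_integral_le {T : ℝ} {η g F F' K : ℝ → ℝ → ℝ}
    (hg : ContinuousOn (fun p : ℝ × ℝ => g p.1 p.2) (univ ×ˢ Icc 0 T))
    (hη : ∀ x, ∀ t ∈ Icc (0 : ℝ) T, HasDerivWithinAt (η x) (g x t) (Icc 0 T) t)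
    (hηc : ∀ t ∈ Icc (0 : ℝ) T, Continuous fun x => η x t)
    (hF : ∀ x, ∀ t ∈ Icc (0 : ℝ) T, HasDerivAt (fun y => F y t) (F' x t) x)
    (hF' : ∀ t ∈ Icc (0 : ℝ) T, Continuous fun x => F' x t)
    (hle : ∀ x, ∀ t ∈ Icc (0 : ℝ) T, ∀ p q : ℝ,
      p ^ 2 * g x t ≤ p ^ 2 * F' x t + 2 * p * q * F x t + (q ^ 2 + |2 * p * q|) * K x t)
    (hK0 : ∀ x, ∀ t ∈ Icc (0 : ℝ) T, 0 ≤ K x t)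
    {ε C : ℝ} (hε : 0 ≤ ε) (hC : 0 ≤ C)
    (hK : ∀ x, ∀ t ∈ Icc (0 : ℝ) T, K x t ≤ ε + C * (1 + x ^ 2)⁻¹)
    {t : ℝ} (ht : t ∈ Icc (0 : ℝ) T) {L : ℝ} (hL : 1 ≤ L) :
    ∫ x in (-L)..L, (1 - (x / L) ^ 2) ^ 2 * η x t
      ≤ (∫ x in (-L)..L, (1 - (x / L) ^ 2) ^ 2 * η x 0) + T * (16 * ε + 32 * C / L) := by
  have hL0 : 0 < L := by linarith
  have h0 : (0 : ℝ) ∈ Icc (0 : ℝ) T := ⟨le_rfl, ht.1.trans ht.2⟩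
  have hsub : Icc 0 t ⊆ Icc 0 T := Icc_subset_Icc_right ht.2
  have hgx : ∀ s ∈ Icc (0 : ℝ) T, Continuous fun x => g x s := fun s hs =>
    hg.comp_continuous (f := fun x => (x, s)) (by fun_prop) fun x => ⟨mem_univ _, hs⟩
  have hgt : ∀ x, ContinuousOn (g x) (Icc 0 t) := fun x =>
    hg.comp (f := fun s => (x, s)) (by fun_prop) fun s hs => ⟨mem_univ _, hsub hs⟩
  have hspace : ∀ s ∈ Icc (0 : ℝ) T,
      ∫ x in (-L)..L, (1 - (x / L) ^ 2) ^ 2 * g x s ≤ 16 * ε + 32 * C / L := by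
    intro s hs
    have hFc : Continuous fun x => F x s :=
      continuous_iff_continuousAt.2 fun x => (hF x s hs).continuousAt
    have hder : ∀ x, HasDerivAt (fun y => (1 - (y / L) ^ 2) ^ 2 * F y s)
        ((1 - (x / L) ^ 2) ^ 2 * F' x s
          + 2 * (1 - (x / L) ^ 2) * (-(2 * x / L ^ 2)) * F x s) x := by
      intro x
      have h1 : HasDerivAt (fun y : ℝ => (1 - (y / L) ^ 2) ^ 2)
          (2 * (1 - (x / L) ^ 2) * (-(2 * x / L ^ 2))) x := by
        have := ((((hasDerivAt_id x).div_const L).pow 2).const_sub 1).pow 2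
        refine this.congr_deriv ?_
        simp only [Pi.pow_apply, id, Nat.add_one_sub_one, pow_one]
        push_cast
        ring
      exact (h1.mul (hF x s hs)).congr_deriv (by ring)
    have hF's := hF' s hs
    have hint := intervalIntegral.integral_eq_sub_of_hasDerivAt (a := -L) (b := L)
      (fun x _ => hder x) (Continuous.intervalIntegrable (by fun_prop) _ _)
    have hv : (1 - (L / L) ^ 2 : ℝ) = 0 := by rw [div_self hL0.ne']; ring
    have hv' : (1 - (-L / L) ^ 2 : ℝ) = 0 := by rw [neg_div, div_self hL0.ne']; ring
    rw [hv, hv'] at hint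
    have hbd : ∫ x in (-L)..L, (1 - (x / L) ^ 2) ^ 2 * g x s
        ≤ ∫ x in (-L)..L, (((1 - (x / L) ^ 2) ^ 2 * F' x s
          + 2 * (1 - (x / L) ^ 2) * (-(2 * x / L ^ 2)) * F x s)
          + 8 / L * (ε + C * (1 + x ^ 2)⁻¹)) := by
      have hgs := hgx s hs
      have hne : ∀ x : ℝ, 1 + x ^ 2 ≠ 0 := fun x => by positivity
      apply intervalIntegral.integral_mono_on (by linarith)
      · exact Continuous.intervalIntegrable (by fun_prop) _ _
      · exact Continuous.intervalIntegrable (by fun_prop (disch := assumption)) _ _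
      · intro x hx
        have hxL : |x| ≤ L := abs_le.2 hx
        have hp : |1 - (x / L) ^ 2| ≤ 1 := by
          have h1 : (x / L) ^ 2 ≤ 1 := by
            rw [← sq_abs, abs_div, abs_of_pos hL0]
            exact pow_le_one₀ (by positivity) ((div_le_one hL0).2 hxL)
          have h2 := sq_nonneg (x / L)
          rw [abs_le]; constructor <;> linarith
        have hq : |-(2 * x / L ^ 2)| ≤ 2 / L := by
          rw [abs_neg, abs_div, abs_mul, abs_two, abs_of_pos (pow_pos hL0 2),
            div_le_div_iff₀ (by positivity) hL0]
          nlinarith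
        have hq2 : (-(2 * x / L ^ 2)) ^ 2 ≤ 4 / L := by
          rw [← sq_abs]
          calc _ ≤ (2 / L) ^ 2 := pow_le_pow_left₀ (abs_nonneg _) hq 2
            _ ≤ 4 / L := by
              rw [div_pow, div_le_div_iff₀ (by positivity) hL0]
              nlinarith
        have hpq : |2 * (1 - (x / L) ^ 2) * (-(2 * x / L ^ 2))| ≤ 4 / L := by
          rw [abs_mul, abs_mul, abs_two]
          calc 2 * |1 - (x / L) ^ 2| * |-(2 * x / L ^ 2)| ≤ 2 * 1 * (2 / L) := by gcongr
            _ = 4 / L := by ring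
        refine (hle x s hs _ (-(2 * x / L ^ 2))).trans ?_
        refine add_le_add le_rfl (mul_le_mul ?_ (hK x s hs) (hK0 x s hs) (by positivity))
        calc _ ≤ 4 / L + 4 / L := add_le_add hq2 hpq
          _ = 8 / L := by ring
    refine hbd.trans ?_
    have hne : ∀ x : ℝ, 1 + x ^ 2 ≠ 0 := fun x => by positivity
    rw [intervalIntegral.integral_add
      (Continuous.intervalIntegrable (by fun_prop) _ _)
      (Continuous.intervalIntegrable (by fun_prop (disch := assumption)) _ _), hint,
      intervalIntegral.integral_const_mul, intervalIntegral.integral_add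
      (Continuous.intervalIntegrable (by fun_prop) _ _)
      (Continuous.intervalIntegrable (by fun_prop (disch := assumption)) _ _),
      intervalIntegral.integral_const_mul, integral_inv_one_add_sq]
    have h1 := Real.arctan_lt_pi_div_two L
    have h2 := Real.neg_pi_div_two_lt_arctan (-L)
    have h3 := Real.pi_le_four
    have h4 : C * (Real.arctan L - Real.arctan (-L)) ≤ C * 4 := by gcongr; linarith
    calc _ = 16 * ε + 8 / L * (C * (Real.arctan L - Real.arctan (-L))) := by
          simp; field_simp; ring
      _ ≤ 16 * ε + 8 / L * (C * 4) := by gcongr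
      _ = _ := by ring
  have htime : ∀ x, ∫ s in (0 : ℝ)..t, (1 - (x / L) ^ 2) ^ 2 * g x s
      = (1 - (x / L) ^ 2) ^ 2 * η x t - (1 - (x / L) ^ 2) ^ 2 * η x 0 := by
    intro x
    rw [intervalIntegral.integral_const_mul, ← mul_sub]
    congr 1
    apply intervalIntegral.integral_eq_sub_of_hasDerivAt_of_le ht.1
    · exact fun s hs => (hη x s (hsub hs)).continuousWithinAt.mono hsub
    · exact fun s hs => (hη x s (hsub ⟨hs.1.le, hs.2.le⟩)).hasDerivAt
        (Icc_mem_nhds hs.1 (hs.2.trans_le ht.2))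
    · exact ContinuousOn.intervalIntegrable (by rw [uIcc_of_le ht.1]; exact hgt x)
  have hjoint : ContinuousOn (fun p : ℝ × ℝ => (1 - (p.1 / L) ^ 2) ^ 2 * g p.1 p.2)
      (Icc (-L) L ×ˢ Icc 0 t) :=
    ContinuousOn.mul (by fun_prop) (hg.mono (prod_mono (subset_univ _) hsub))
  have hswap : ∫ x in (-L)..L, ∫ s in (0 : ℝ)..t, (1 - (x / L) ^ 2) ^ 2 * g x s
      = ∫ s in (0 : ℝ)..t, ∫ x in (-L)..L, (1 - (x / L) ^ 2) ^ 2 * g x s := by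
    apply intervalIntegral_intervalIntegral_swap
    refine (hjoint.integrableOn_compact (isCompact_Icc.prod isCompact_Icc)).mono_set ?_
    rw [uIoc_of_le (by linarith), uIoc_of_le ht.1]
    exact prod_mono Ioc_subset_Icc_self Ioc_subset_Icc_self
  have hηt := hηc t ht
  have hη0 := hηc 0 h0
  simp_rw [htime] at hswap
  rw [intervalIntegral.integral_sub (Continuous.intervalIntegrable (by fun_prop) _ _)
    (Continuous.intervalIntegrable (by fun_prop) _ _)] at hswap
  have hfin : ∫ s in (0 : ℝ)..t, ∫ x in (-L)..L, (1 - (x / L) ^ 2) ^ 2 * g x s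
      ≤ T * (16 * ε + 32 * C / L) := by
    have hD : 0 ≤ 16 * ε + 32 * C / L := by positivity
    by_cases hi : IntervalIntegrable
        (fun s => ∫ x in (-L)..L, (1 - (x / L) ^ 2) ^ 2 * g x s) volume 0 t
    · calc _ ≤ ∫ _ in (0 : ℝ)..t, (16 * ε + 32 * C / L) :=
            intervalIntegral.integral_mono_on ht.1 hi (by simp) fun s hs => hspace s (hsub hs)
        _ = t * (16 * ε + 32 * C / L) := by
            rw [intervalIntegral.integral_const, sub_zero, smul_eq_mul]
        _ ≤ _ := by gcongr; exact ht.2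
    · rw [intervalIntegral.integral_undef hi]
      have := ht.1.trans ht.2
      positivity
  linarith

theorem HasDerivWithinAt.prod_fst {f : ℝ → ℝ × ℝ} {f' : ℝ × ℝ} {s : Set ℝ} {x : ℝ}
    (h : HasDerivWithinAt f f' s x) : HasDerivWithinAt (fun y => (f y).1) f'.1 s x :=
  (ContinuousLinearMap.fst ℝ ℝ ℝ).hasFDerivAt.comp_hasDerivWithinAt x h

theorem HasDerivWithinAt.prod_snd {f : ℝ → ℝ × ℝ} {f' : ℝ × ℝ} {s : Set ℝ} {x : ℝ}
    (h : HasDerivWithinAt f f' s x) : HasDerivWithinAt (fun y => (f y).2) f'.2 s x :=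
  (ContinuousLinearMap.snd ℝ ℝ ℝ).hasFDerivAt.comp_hasDerivWithinAt x h

theorem HasDerivAt.prod_fst {f : ℝ → ℝ × ℝ} {f' : ℝ × ℝ} {x : ℝ}
    (h : HasDerivAt f f' x) : HasDerivAt (fun y => (f y).1) f'.1 x :=
  (ContinuousLinearMap.fst ℝ ℝ ℝ).hasFDerivAt.comp_hasDerivAt x h

theorem HasDerivAt.prod_snd {f : ℝ → ℝ × ℝ} {f' : ℝ × ℝ} {x : ℝ}
    (h : HasDerivAt f f' x) : HasDerivAt (fun y => (f y).2) f'.2 x :=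
  (ContinuousLinearMap.snd ℝ ℝ ℝ).hasFDerivAt.comp_hasDerivAt x h

theorem sq2_nonneg (p : ℝ × ℝ) : 0 ≤ sq2 p := by unfold sq2; positivity

theorem visc_nonneg {α z : ℝ} (hα : 0 ≤ α) (hz : 0 < z) : 0 ≤ visc α z := by
  unfold visc; positivity

/-- Euclidean inner product on `ℝ × ℝ`. -/
def dot2 (p q : ℝ × ℝ) : ℝ := p.1 * q.1 + p.2 * q.2

/-- Relative entropy density of the state `(1, 0, 1, 0, 0)`. -/
def entropy (v u θ : ℝ → ℝ → ℝ) (w b : ℝ → ℝ → ℝ × ℝ) (x t : ℝ) : ℝ :=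
  ((u x t) ^ 2 + sq2 (w x t) + v x t * sq2 (b x t)) / 2
    + (v x t - Real.log (v x t) - 1) + (θ x t - Real.log (θ x t) - 1)

/-- Time derivative of the entropy density. -/
def entropyRate (T : ℝ) (v u θ : ℝ → ℝ → ℝ) (w b : ℝ → ℝ → ℝ × ℝ) (x t : ℝ) : ℝ :=
  u x t * pdt T u x t + dot2 (w x t) (pdt T w x t)
    + (pdt T v x t * sq2 (b x t) / 2 + v x t * dot2 (b x t) (pdt T b x t))
    + (1 - (v x t)⁻¹) * pdt T v x t + (1 - (θ x t)⁻¹) * pdt T θ x t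

/-- Entropy flux. -/
def entropyFlux (α β : ℝ) (v u θ : ℝ → ℝ → ℝ) (w b : ℝ → ℝ → ℝ × ℝ) (x t : ℝ) : ℝ :=
  u x t * (visc α (v x t) * pdx u x t / v x t)
    + u x t * (1 - (θ x t / v x t + sq2 (b x t) / 2)) + dot2 (w x t) (b x t)
    + dot2 (w x t) ((v x t)⁻¹ • pdx w x t) + dot2 (b x t) ((v x t)⁻¹ • pdx b x t)
    + (1 - (θ x t)⁻¹) * (θ x t ^ β * pdx θ x t / v x t)

/-- Entropy dissipation. -/
def dissipation (α β : ℝ) (v u θ : ℝ → ℝ → ℝ) (w b : ℝ → ℝ → ℝ × ℝ) (x t : ℝ) : ℝ :=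
  (visc α (v x t) * pdx u x t ^ 2 + sq2 (pdx w x t) + sq2 (pdx b x t)) / (θ x t * v x t)
    + θ x t ^ β * pdx θ x t ^ 2 / (v x t * θ x t ^ 2)

/-- The state function controlling the error made by localizing the entropy balance. -/
def cutoffError (α β : ℝ) (U : ℝ × ℝ × ℝ × (ℝ × ℝ) × (ℝ × ℝ)) : ℝ :=
  ((U.2.1 ^ 2 * visc α U.1 + sq2 U.2.2.2.1 + sq2 U.2.2.2.2) * U.2.2.1
      + (U.2.2.1 - 1) ^ 2 * U.2.2.1 ^ β) / U.1
    + |U.2.1 * (1 - (U.2.2.1 / U.1 + sq2 U.2.2.2.2 / 2)) + dot2 U.2.2.2.1 U.2.2.2.2|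

theorem continuousAt_cutoffError {α β : ℝ} {U : ℝ × ℝ × ℝ × (ℝ × ℝ) × (ℝ × ℝ)}
    (h₁ : 0 < U.1) (h₂ : 0 < U.2.2.1) : ContinuousAt (cutoffError α β) U := by
  set S : Set (ℝ × ℝ × ℝ × (ℝ × ℝ) × (ℝ × ℝ)) := {V | 0 < V.1 ∧ 0 < V.2.2.1}
  have hopen : IsOpen S :=
    (isOpen_lt continuous_const continuous_fst).and
      (isOpen_lt continuous_const (continuous_fst.comp (continuous_snd.comp continuous_snd)))
  have n₁ : ∀ V ∈ S, V.1 ≠ 0 := fun V hV => hV.1.ne'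
  have e₁ : ContinuousOn (fun V : ℝ × ℝ × ℝ × (ℝ × ℝ) × (ℝ × ℝ) => V.1 ^ (-α)) S :=
    ContinuousOn.rpow_const (by fun_prop) fun V hV => Or.inl hV.1.ne'
  have e₂ : ContinuousOn (fun V : ℝ × ℝ × ℝ × (ℝ × ℝ) × (ℝ × ℝ) => V.2.2.1 ^ β) S :=
    ContinuousOn.rpow_const (by fun_prop) fun V hV => Or.inl hV.2.ne'
  suffices h : ContinuousOn (cutoffError α β) S from h.continuousAt (hopen.mem_nhds ⟨h₁, h₂⟩)
  unfold cutoffError visc sq2 dot2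
  fun_prop (disch := assumption)

theorem cutoffError_nonneg {α β : ℝ} (hα : 0 ≤ α) {U : ℝ × ℝ × ℝ × (ℝ × ℝ) × (ℝ × ℝ)}
    (h₁ : 0 < U.1) (h₂ : 0 < U.2.2.1) : 0 ≤ cutoffError α β U := by
  have := visc_nonneg hα h₁
  have := sq2_nonneg U.2.2.2.1
  have := sq2_nonneg U.2.2.2.2
  unfold cutoffError
  positivity

namespace IsClassicalSolution

variable {α β T : ℝ} {v u θ : ℝ → ℝ → ℝ} {w b : ℝ → ℝ → ℝ × ℝ}

theorem hasDerivWithinAt_entropy (h : IsClassicalSolution α β T v u θ w b) (x : ℝ)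
    {t : ℝ} (ht : t ∈ Icc 0 T) :
    HasDerivWithinAt (entropy v u θ w b x) (entropyRate T v u θ w b x t) (Icc 0 T) t := by
  obtain ⟨dv, du, dθ, dw, db⟩ := h.diff_t x t ht
  have hv := dv.hasDerivWithinAt
  have hu := du.hasDerivWithinAt
  have hθ := dθ.hasDerivWithinAt
  have hw := dw.hasDerivWithinAt
  have hb := db.hasDerivWithinAt
  have hw₁ := hw.prod_fst
  have hw₂ := hw.prod_snd
  have hb₁ := hb.prod_fst
  have hb₂ := hb.prod_snd
  have hlv := hv.log (h.v_pos x t ht).ne'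
  have hlθ := hθ.log (h.θ_pos x t ht).ne'
  refine ((((((hu.pow 2).add ((hw₁.pow 2).add (hw₂.pow 2))).add
    (hv.mul ((hb₁.pow 2).add (hb₂.pow 2)))).div_const 2).add
    ((hv.sub hlv).sub_const 1)).add ((hθ.sub hlθ).sub_const 1)).congr_deriv ?_
  simp only [entropyRate, pdt, dot2, sq2, Pi.add_apply, Pi.pow_apply, Nat.add_one_sub_one, pow_one]
  push_cast
  ring

theorem hasDerivAt_entropyFlux (h : IsClassicalSolution α β T v u θ w b) (hT : 0 < T) (x : ℝ)
    {t : ℝ} (ht : t ∈ Icc 0 T) :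
    HasDerivAt (fun y => entropyFlux α β v u θ w b y t)
      (entropyRate T v u θ w b x t + dissipation α β v u θ w b x t) x := by
  obtain ⟨dv, du, dθ, dw, db⟩ := h.diff_x x t ht
  obtain ⟨dux, dθx, dwx, dbx⟩ := h.diff_xx x t ht
  have pv := h.v_pos x t ht
  have pθ := h.θ_pos x t ht
  have nv := pv.ne'
  have nθ := pθ.ne'
  have db₁ : DifferentiableAt ℝ (fun y => (b y t).1) x := db.hasDerivAt.prod_fst.differentiableAt
  have db₂ : DifferentiableAt ℝ (fun y => (b y t).2) x := db.hasDerivAt.prod_snd.differentiableAt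
  have hP : DifferentiableAt ℝ (fun y => θ y t / v y t + sq2 (b y t) / 2) x := by
    unfold sq2; fun_prop (disch := assumption)
  have hvisc : DifferentiableAt ℝ (fun y => visc α (v y t)) x := by
    unfold visc
    exact ((dv.rpow_const (Or.inl nv)).const_mul α).const_add 1
  have hS : DifferentiableAt ℝ (fun y => visc α (v y t) * pdx u y t / v y t) x :=
    (hvisc.mul dux).div dv nv
  have hQ : DifferentiableAt ℝ (fun y => θ y t ^ β * pdx θ y t / v y t) x :=
    ((dθ.rpow_const (Or.inl nθ)).mul dθx).div dv nv
  have hW : DifferentiableAt ℝ (fun y => (v y t)⁻¹ • pdx w y t) x := (dv.inv nv).smul dwx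
  have hB : DifferentiableAt ℝ (fun y => (v y t)⁻¹ • pdx b y t) x := (dv.inv nv).smul dbx
  have hvb : pdt T (fun y s => v y s • b y s) x t
      = v x t • pdt T b x t + pdt T v x t • b x t := by
    obtain ⟨tv, -, -, -, tb⟩ := h.diff_t x t ht
    exact (tv.hasDerivWithinAt.smul tb.hasDerivWithinAt).derivWithin
      (uniqueDiffOn_Icc hT t ht)
  have eu := h.eq_mom x t ht
  have ew := h.eq_w x t ht
  have eb := h.eq_b x t ht
  have eθ := h.eq_temp x t ht
  have ev := h.eq_mass x t ht
  rw [hvb] at eb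
  have hP' : HasDerivAt (fun y => θ y t / v y t + sq2 (b y t) / 2)
    (pdx (fun y s => θ y s / v y s + sq2 (b y s) / 2) x t) x := hP.hasDerivAt
  generalize pdx (fun y s => θ y s / v y s + sq2 (b y s) / 2) x t = P' at hP' eu
  have ew₁ := congrArg Prod.fst ew
  have ew₂ := congrArg Prod.snd ew
  have eb₁ := congrArg Prod.fst eb
  have eb₂ := congrArg Prod.snd eb
  have hv := dv.hasDerivAt
  have hu := du.hasDerivAt
  have hθ := dθ.hasDerivAt
  have hw := dw.hasDerivAt
  have hb := db.hasDerivAt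
  have kW := hW.hasDerivAt
  have kB := hB.hasDerivAt
  refine ((((((hu.mul hS.hasDerivAt).add (hu.mul (hP'.const_sub 1))).add
    ((hw.prod_fst.mul hb.prod_fst).add (hw.prod_snd.mul hb.prod_snd))).add
    ((hw.prod_fst.mul kW.prod_fst).add (hw.prod_snd.mul kW.prod_snd))).add
    ((hb.prod_fst.mul kB.prod_fst).add (hb.prod_snd.mul kB.prod_snd))).add
    (((hθ.inv nθ).const_sub 1).mul hQ.hasDerivAt)).congr_deriv ?_
  have hS' : deriv (fun y => visc α (v y t) * pdx u y t / v y t) x = _ := eu.symm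
  have hQ' : deriv (fun y => θ y t ^ β * pdx θ y t / v y t) x = _ := (sub_eq_of_eq_add eθ).symm
  have hW₁' : (deriv (fun y => (v y t)⁻¹ • pdx w y t) x).1 = _ := ew₁.symm
  have hW₂' : (deriv (fun y => (v y t)⁻¹ • pdx w y t) x).2 = _ := ew₂.symm
  have hB₁' : (deriv (fun y => (v y t)⁻¹ • pdx b y t) x).1 = _ := eb₁.symm
  have hB₂' : (deriv (fun y => (v y t)⁻¹ • pdx b y t) x).2 = _ := eb₂.symm
  rw [hS', hQ', hW₁', hW₂', hB₁', hB₂']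
  have ev' : deriv (fun y => u y t) x = pdt T v x t := ev.symm
  simp only [← pdx.eq_1] at *
  simp only [entropyRate, dissipation, dot2, sq2, Prod.fst_sub, Prod.snd_sub, Prod.fst_add,
    Prod.snd_add, Prod.smul_fst, Prod.smul_snd, smul_eq_mul, ev', Pi.inv_apply]
  field_simp
  ring

theorem mul_entropyRate_le (h : IsClassicalSolution α β T v u θ w b) (hα : 0 ≤ α) (x : ℝ)
    {t : ℝ} (ht : t ∈ Icc 0 T) (p q : ℝ) :
    p ^ 2 * entropyRate T v u θ w b x t
      ≤ p ^ 2 * (entropyRate T v u θ w b x t + dissipation α β v u θ w b x t)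
        + 2 * p * q * entropyFlux α β v u θ w b x t
        + (q ^ 2 + |2 * p * q|) * cutoffError α β (v x t, u x t, θ x t, w x t, b x t) := by
  have pv := h.v_pos x t ht
  have pθ := h.θ_pos x t ht
  have pμ := visc_nonneg hα pv
  set μ := visc α (v x t)
  set κ := θ x t ^ β with hκ
  have pκ : 0 < κ := by positivity
  set R := u x t * (1 - (θ x t / v x t + sq2 (b x t) / 2)) + dot2 (w x t) (b x t) with hR
  set A := ((u x t ^ 2 * μ + sq2 (w x t) + sq2 (b x t)) * θ x t + (θ x t - 1) ^ 2 * κ) / v x t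
    with hA
  have pA : 0 ≤ A := by
    have := sq2_nonneg (w x t)
    have := sq2_nonneg (b x t)
    positivity
  have hE : cutoffError α β (v x t, u x t, θ x t, w x t, b x t) = A + |R| := rfl
  have hsq : 0 ≤ θ x t / v x t * (μ * (p * pdx u x t / θ x t + q * u x t) ^ 2
      + (p * (pdx w x t).1 / θ x t + q * (w x t).1) ^ 2
      + (p * (pdx w x t).2 / θ x t + q * (w x t).2) ^ 2
      + (p * (pdx b x t).1 / θ x t + q * (b x t).1) ^ 2
      + (p * (pdx b x t).2 / θ x t + q * (b x t).2) ^ 2)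
      + κ / v x t * (p * pdx θ x t / θ x t + q * (θ x t - 1)) ^ 2 := by positivity
  have hid : p ^ 2 * dissipation α β v u θ w b x t + 2 * p * q * entropyFlux α β v u θ w b x t
      + q ^ 2 * A - 2 * p * q * R = θ x t / v x t * (μ * (p * pdx u x t / θ x t + q * u x t) ^ 2
      + (p * (pdx w x t).1 / θ x t + q * (w x t).1) ^ 2
      + (p * (pdx w x t).2 / θ x t + q * (w x t).2) ^ 2
      + (p * (pdx b x t).1 / θ x t + q * (b x t).1) ^ 2
      + (p * (pdx b x t).2 / θ x t + q * (b x t).2) ^ 2)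
      + κ / v x t * (p * pdx θ x t / θ x t + q * (θ x t - 1)) ^ 2 := by
    simp only [hA, hR, dissipation, entropyFlux, dot2, sq2, Prod.smul_fst, Prod.smul_snd,
      smul_eq_mul, ← hκ]
    field_simp
    ring
  have h1 : -(|2 * p * q| * |R|) ≤ 2 * p * q * R := by
    rw [← abs_mul]; exact neg_abs_le _
  have h2 : 0 ≤ q ^ 2 * |R| := by positivity
  have h3 : 0 ≤ |2 * p * q| * A := by positivity
  rw [hE]
  linarith


theorem continuousOn_components (h : IsClassicalSolution α β T v u θ w b) :
    ContinuousOn (fun p : ℝ × ℝ => v p.1 p.2) (univ ×ˢ Icc 0 T) ∧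
    ContinuousOn (fun p : ℝ × ℝ => u p.1 p.2) (univ ×ˢ Icc 0 T) ∧
    ContinuousOn (fun p : ℝ × ℝ => θ p.1 p.2) (univ ×ˢ Icc 0 T) ∧
    ContinuousOn (fun p : ℝ × ℝ => w p.1 p.2) (univ ×ˢ Icc 0 T) ∧
    ContinuousOn (fun p : ℝ × ℝ => b p.1 p.2) (univ ×ˢ Icc 0 T) :=
  ⟨h.cont.fst, h.cont.snd.fst, h.cont.snd.snd.fst, h.cont.snd.snd.snd.fst,
    h.cont.snd.snd.snd.snd⟩

theorem continuousOn_entropy (h : IsClassicalSolution α β T v u θ w b) :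
    ContinuousOn (fun p : ℝ × ℝ => entropy v u θ w b p.1 p.2) (univ ×ˢ Icc 0 T) := by
  obtain ⟨hv, hu, hθ, hw, hb⟩ := h.continuousOn_components
  have hlv := hv.log fun p hp => (h.v_pos p.1 p.2 hp.2).ne'
  have hlθ := hθ.log fun p hp => (h.θ_pos p.1 p.2 hp.2).ne'
  unfold entropy sq2
  fun_prop

theorem continuousOn_entropyRate (h : IsClassicalSolution α β T v u θ w b) :
    ContinuousOn (fun p : ℝ × ℝ => entropyRate T v u θ w b p.1 p.2) (univ ×ˢ Icc 0 T) := by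
  obtain ⟨hv, hu, hθ, hw, hb⟩ := h.continuousOn_components
  have tv := h.cont_dt.fst
  have tu := h.cont_dt.snd.fst
  have tθ := h.cont_dt.snd.snd.fst
  have tw := h.cont_dt.snd.snd.snd.fst
  have tb := h.cont_dt.snd.snd.snd.snd
  have nv : ∀ p ∈ (univ : Set ℝ) ×ˢ Icc 0 T, v p.1 p.2 ≠ 0 :=
    fun p hp => (h.v_pos p.1 p.2 hp.2).ne'
  have nθ : ∀ p ∈ (univ : Set ℝ) ×ˢ Icc 0 T, θ p.1 p.2 ≠ 0 :=
    fun p hp => (h.θ_pos p.1 p.2 hp.2).ne'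
  unfold entropyRate dot2 sq2
  fun_prop (disch := assumption)

theorem continuousOn_dissipation (h : IsClassicalSolution α β T v u θ w b) :
    ContinuousOn (fun p : ℝ × ℝ => dissipation α β v u θ w b p.1 p.2) (univ ×ˢ Icc 0 T) := by
  obtain ⟨hv, hu, hθ, hw, hb⟩ := h.continuousOn_components
  have xu := h.cont_dx.snd.fst
  have xθ := h.cont_dx.snd.snd.fst
  have xw := h.cont_dx.snd.snd.snd.fst
  have xb := h.cont_dx.snd.snd.snd.snd
  have nv : ∀ p ∈ (univ : Set ℝ) ×ˢ Icc 0 T, v p.1 p.2 ≠ 0 :=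
    fun p hp => (h.v_pos p.1 p.2 hp.2).ne'
  have nθ : ∀ p ∈ (univ : Set ℝ) ×ˢ Icc 0 T, θ p.1 p.2 ≠ 0 :=
    fun p hp => (h.θ_pos p.1 p.2 hp.2).ne'
  have rv := hv.rpow_const (p := -α) fun p hp => Or.inl (nv p hp)
  have rθ := hθ.rpow_const (p := β) fun p hp => Or.inl (nθ p hp)
  unfold dissipation visc sq2
  exact .add
    (.div (by fun_prop) (by fun_prop) fun p hp => mul_ne_zero (nθ p hp) (nv p hp))
    (.div (by fun_prop) (by fun_prop) fun p hp => mul_ne_zero (nv p hp) (pow_ne_zero 2 (nθ p hp)))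

theorem continuousOn_cutoffError (h : IsClassicalSolution α β T v u θ w b) :
    ContinuousOn (fun p : ℝ × ℝ => cutoffError α β
      (v p.1 p.2, u p.1 p.2, θ p.1 p.2, w p.1 p.2, b p.1 p.2)) (univ ×ˢ Icc 0 T) :=
  fun p hp => (continuousAt_cutoffError (h.v_pos p.1 p.2 hp.2)
    (h.θ_pos p.1 p.2 hp.2)).comp_continuousWithinAt
      (f := fun p : ℝ × ℝ => (v p.1 p.2, u p.1 p.2, θ p.1 p.2, w p.1 p.2, b p.1 p.2)) (h.cont p hp)

theorem cutoffError_farfield (h : IsClassicalSolution α β T v u θ w b) {ε : ℝ} (hε : 0 < ε) :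
    ∃ M : ℝ, ∀ x, ∀ t ∈ Icc (0 : ℝ) T, M ≤ |x| →
      cutoffError α β (v x t, u x t, θ x t, w x t, b x t) < ε := by
  have hc : ContinuousAt (cutoffError α β) (1, 0, 1, (0, 0), (0, 0)) :=
    continuousAt_cutoffError one_pos one_pos
  have h0 : cutoffError α β (1, 0, 1, (0, 0), (0, 0)) = 0 := by
    simp [cutoffError, sq2, dot2]
  obtain ⟨δ, hδ, hball⟩ := Metric.continuousAt_iff.1 hc ε hε
  obtain ⟨M, hM⟩ := h.farfield δ hδ
  refine ⟨M, fun x t ht hx => ?_⟩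
  obtain ⟨hv, hu, hθ, hb, hw⟩ := hM x t ht hx
  have hfst : ∀ p : ℝ × ℝ, |p.1| ≤ √(sq2 p) := fun p =>
    Real.abs_le_sqrt (by unfold sq2; nlinarith)
  have hsnd : ∀ p : ℝ × ℝ, |p.2| ≤ √(sq2 p) := fun p =>
    Real.abs_le_sqrt (by unfold sq2; nlinarith)
  have key := @hball (v x t, u x t, θ x t, w x t, b x t) (by
    simp only [Prod.dist_eq, Real.dist_eq, max_lt_iff, sub_zero]
    exact ⟨hv, hu, hθ, ⟨(hfst _).trans_lt hw, (hsnd _).trans_lt hw⟩,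
      ⟨(hfst _).trans_lt hb, (hsnd _).trans_lt hb⟩⟩)
  rw [h0, Real.dist_eq, sub_zero] at key
  exact (le_abs_self _).trans_lt key

theorem sub_log_le_entropy (h : IsClassicalSolution α β T v u θ w b) (x : ℝ) {t : ℝ}
    (ht : t ∈ Icc 0 T) :
    0 ≤ entropy v u θ w b x t ∧ v x t - Real.log (v x t) - 1 ≤ entropy v u θ w b x t ∧
      θ x t - Real.log (θ x t) - 1 ≤ entropy v u θ w b x t := by
  have pv := h.v_pos x t ht
  have h₁ := Real.log_le_sub_one_of_pos pv
  have h₂ := Real.log_le_sub_one_of_pos (h.θ_pos x t ht)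
  have h₃ : 0 ≤ ((u x t) ^ 2 + sq2 (w x t) + v x t * sq2 (b x t)) / 2 := by
    have := sq2_nonneg (w x t)
    have := sq2_nonneg (b x t)
    positivity
  unfold entropy
  refine ⟨?_, ?_, ?_⟩ <;> linarith

/-- The entropy at any time in a unit cell is at most twice the initial total entropy. -/
theorem integral_entropy_cell_le (h : IsClassicalSolution α β T v u θ w b) (hα : 0 ≤ α)
    (hT : 0 < T) (hint : Integrable fun x => entropy v u θ w b x 0)
    (hpos : 0 < ∫ x, entropy v u θ w b x 0) (a : ℝ) {t : ℝ} (ht : t ∈ Icc 0 T) :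
    ∫ x in a..(a + 1), entropy v u θ w b x t ≤ 2 * ∫ x, entropy v u θ w b x 0 := by
  set E := ∫ x, entropy v u θ w b x 0
  have hslice {f : ℝ → ℝ → ℝ} (hf : ContinuousOn (fun p : ℝ × ℝ => f p.1 p.2) (univ ×ˢ Icc 0 T))
      {s : ℝ} (hs : s ∈ Icc 0 T) : Continuous fun x => f x s :=
    hf.comp_continuous (f := fun x => (x, s)) (by fun_prop) fun x => ⟨mem_univ _, hs⟩
  have h0 : (0 : ℝ) ∈ Icc 0 T := ⟨le_rfl, hT.le⟩
  have hη := hslice h.continuousOn_entropy ht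
  have hη0 := hslice h.continuousOn_entropy h0
  obtain ⟨C, hC, hK⟩ := exists_le_add_div_of_tendsto h.continuousOn_cutoffError
    (fun _ => h.cutoffError_farfield) (ε := E / (64 * T)) (by positivity)
  obtain ⟨L, hL⟩ : ∃ L : ℝ, L = max (3 * (|a| + 1)) (128 * C * T / E) := ⟨_, rfl⟩
  have hL₁ : 3 * (|a| + 1) ≤ L := hL ▸ le_max_left _ _
  have hL₂ : 128 * C * T / E ≤ L := hL ▸ le_max_right _ _
  have ha := abs_nonneg a
  have hL0 : 0 < L := by linarith
  have key := weighted_integral_le h.continuousOn_entropyRate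
    (fun x t ht => h.hasDerivWithinAt_entropy x ht)
    (fun t ht => hslice h.continuousOn_entropy ht)
    (fun x t ht => h.hasDerivAt_entropyFlux hT x ht)
    (fun t ht => (hslice h.continuousOn_entropyRate ht).add
      (hslice h.continuousOn_dissipation ht))
    (fun x t ht p q => h.mul_entropyRate_le hα x ht p q)
    (fun x t ht => cutoffError_nonneg hα (h.v_pos x t ht) (h.θ_pos x t ht))
    (by positivity) hC hK ht (L := L) (by linarith)
  have herr : T * (16 * (E / (64 * T)) + 32 * C / L) ≤ E / 2 := by
    have h1 : T * (32 * C / L) ≤ E / 4 := by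
      rw [div_le_iff₀ hpos] at hL₂
      rw [← mul_div_assoc, div_le_iff₀ hL0]
      linarith
    have h2 : T * (16 * (E / (64 * T))) = E / 4 := by field_simp; norm_num
    rw [mul_add, h2]; linarith
  have hcut : ∀ x : ℝ, |x| ≤ L → 0 ≤ 1 - (x / L) ^ 2 ∧ 1 - (x / L) ^ 2 ≤ 1 := fun x hx => by
    have h1 : (x / L) ^ 2 ≤ 1 := by
      rw [← sq_abs, abs_div, abs_of_pos hL0]
      exact pow_le_one₀ (by positivity) ((div_le_one hL0).2 hx)
    have := sq_nonneg (x / L)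
    constructor <;> linarith
  have hinit : ∫ x in (-L)..L, (1 - (x / L) ^ 2) ^ 2 * entropy v u θ w b x 0 ≤ E := by
    calc _ ≤ ∫ x in (-L)..L, entropy v u θ w b x 0 := by
          apply intervalIntegral.integral_mono_on (by linarith)
          · exact Continuous.intervalIntegrable (by fun_prop) _ _
          · exact hη0.intervalIntegrable _ _
          · intro x hx
            obtain ⟨h1, h2⟩ := hcut x (abs_le.2 hx)
            exact mul_le_of_le_one_left (h.sub_log_le_entropy x h0).1 (pow_le_one₀ h1 h2)
      _ ≤ E := by
          rw [intervalIntegral.integral_of_le (by linarith)]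
          exact setIntegral_le_integral hint
            (Eventually.of_forall fun x => (h.sub_log_le_entropy x h0).1)
  have hna := neg_abs_le a
  have hla := le_abs_self a
  have hcell : ∫ x in a..(a + 1), 3 / 4 * entropy v u θ w b x t
      ≤ ∫ x in (-L)..L, (1 - (x / L) ^ 2) ^ 2 * entropy v u θ w b x t := by
    calc _ ≤ ∫ x in a..(a + 1), (1 - (x / L) ^ 2) ^ 2 * entropy v u θ w b x t := by
          apply intervalIntegral.integral_mono_on (by linarith)
          · exact Continuous.intervalIntegrable (by fun_prop) _ _
          · exact Continuous.intervalIntegrable (by fun_prop) _ _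
          · intro x hx
            have hx' : 3 * |x| ≤ L := by
              have : |x| ≤ |a| + 1 := abs_le.2 ⟨by linarith [hx.1], by linarith [hx.2]⟩
              linarith
            have hq : (x / L) ^ 2 ≤ (1 / 3) ^ 2 := by
              rw [← sq_abs, abs_div, abs_of_pos hL0]
              refine pow_le_pow_left₀ (by positivity) ?_ 2
              rw [div_le_iff₀ hL0]; linarith
            refine mul_le_mul_of_nonneg_right ?_ (h.sub_log_le_entropy x ht).1
            nlinarith [sq_nonneg ((x / L) ^ 2)]
      _ ≤ _ := by
          apply intervalIntegral.integral_mono_interval (by linarith) (by linarith) (by linarith)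
          · exact Eventually.of_forall fun x =>
              mul_nonneg (sq_nonneg _) (h.sub_log_le_entropy x ht).1
          · exact Continuous.intervalIntegrable (by fun_prop) _ _
  rw [intervalIntegral.integral_const_mul] at hcell
  linarith

end IsClassicalSolution

/-- (2.14) of the paper: bounds for the averages of `v` and `θ` over
unit cells `[N, N+1]`. -/
theorem cell_average_bounds (α β T : ℝ) (hα : 0 ≤ α) (hβ : 0 < β) (hT : 0 < T)
    (v u θ : ℝ → ℝ → ℝ) (w b : ℝ → ℝ → ℝ × ℝ)
    (hsol : IsClassicalSolution α β T v u θ w b)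
    (e₀ : ℝ)
    (hfin : Integrable (fun x : ℝ =>
      ((u x 0) ^ 2 + sq2 (w x 0) + v x 0 * sq2 (b x 0)) / 2
        + (v x 0 - Real.log (v x 0) - 1) + (θ x 0 - Real.log (θ x 0) - 1)))
    (he₀ : e₀ = 2 * ∫ x : ℝ, (((u x 0) ^ 2 + sq2 (w x 0) + v x 0 * sq2 (b x 0)) / 2
        + (v x 0 - Real.log (v x 0) - 1) + (θ x 0 - Real.log (θ x 0) - 1)))
    (he₀pos : 0 < e₀)
    (α₁ α₂ : ℝ) (hα₁0 : 0 < α₁) (hα₁1 : α₁ < 1) (hα₂ : 1 < α₂)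
    (hroot₁ : α₁ - Real.log α₁ - 1 = e₀) (hroot₂ : α₂ - Real.log α₂ - 1 = e₀) :
    ∀ N : ℤ, ∀ t ∈ Icc (0:ℝ) T,
      (α₁ ≤ ∫ x in (N:ℝ)..(N+1), v x t) ∧ (∫ x in (N:ℝ)..(N+1), v x t) ≤ α₂ ∧
      (α₁ ≤ ∫ x in (N:ℝ)..(N+1), θ x t) ∧ (∫ x in (N:ℝ)..(N+1), θ x t) ≤ α₂ := by
  intro N t ht
  have hcell := hsol.integral_entropy_cell_le hα hT hfin (by unfold entropy; linarith) N ht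
  have hbound : ∫ x in (N : ℝ)..(N + 1), entropy v u θ w b x t ≤ e₀ := he₀ ▸ hcell
  obtain ⟨cv, -, cθ, -, -⟩ := hsol.continuousOn_components
  have hslice {f : ℝ → ℝ → ℝ}
      (hf : ContinuousOn (fun p : ℝ × ℝ => f p.1 p.2) (univ ×ˢ Icc 0 T)) :
      Continuous fun x => f x t :=
    hf.comp_continuous (f := fun x => (x, t)) (by fun_prop) fun x => ⟨mem_univ _, ht⟩
  have hη := hslice hsol.continuousOn_entropy
  have haverage {f : ℝ → ℝ} (hf : Continuous f) (hpos : ∀ x, 0 < f x)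
      (hle : ∀ x, f x - Real.log (f x) - 1 ≤ entropy v u θ w b x t) :
      α₁ ≤ (∫ x in (N : ℝ)..(N + 1), f x) ∧ (∫ x in (N : ℝ)..(N + 1), f x) ≤ α₂ := by
    obtain ⟨hm, hj⟩ := sub_log_integral_le hf hpos N
    have hlog : Continuous fun x => Real.log (f x) := hf.log fun x => (hpos x).ne'
    refine mem_Icc_of_sub_log_le hα₁0 hα₁1 hα₂ hroot₁ hroot₂ hm (hj.trans (le_trans ?_ hbound))
    exact intervalIntegral.integral_mono_on (by linarith)
      (Continuous.intervalIntegrable (by fun_prop) _ _) (hη.intervalIntegrable _ _)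
      fun x _ => hle x
  obtain ⟨hv₁, hv₂⟩ := haverage (hslice cv) (fun x => hsol.v_pos x t ht)
    fun x => (hsol.sub_log_le_entropy x ht).2.1
  obtain ⟨hθ₁, hθ₂⟩ := haverage (hslice cθ) (fun x => hsol.θ_pos x t ht)
    fun x => (hsol.sub_log_le_entropy x ht).2.2
  exact ⟨hv₁, hv₂, hθ₁, hθ₂⟩
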